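/- Let B : ℝ → Set ℝ be a monotone set-valued map with 0 ∈ B(0), let ε > 0, and let (J, b) be a resolvent–Yosida pair for B at parameter ε. Suppose δ > 0 and C ≥ 0 are such that |ξ| ≤ δ·u·ξ + C for every u ∈ ℝ and every ξ ∈ B(u). Then |b(u)| ≤ δ·u·b(u) + C for every u ∈ ℝ; that is, the Yosida approximation satisfies the same estimate with the same constants. -/

import Mathlib

/-- A set-valued map `B : ℝ → Set ℝ` is monotone if
`(ξ - ζ) * (x - y) ≥ 0` whenever `ξ ∈ B x` and `ζ ∈ B y`. -/
def MonotoneSetMap (B : ℝ → Set ℝ) : Prop :=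
  ∀ x y ξ ζ : ℝ, ξ ∈ B x → ζ ∈ B y → (ξ - ζ) * (x - y) ≥ 0

/-- `(J, b)` is a resolvent–Yosida pair for `B` at parameter `ε`:
`g = J g + ε * b g` and `b g ∈ B (J g)` for all `g`. -/
def ResolventYosidaPair (B : ℝ → Set ℝ) (ε : ℝ) (J b : ℝ → ℝ) : Prop :=
  ∀ g : ℝ, g = J g + ε * b g ∧ b g ∈ B (J g)

/-- The structural estimate `|ξ| ≤ δ u ξ + C` for `ξ ∈ B u` is inherited by the
Yosida approximation: `|b u| ≤ δ u (b u) + C` for all `u`. -/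
theorem yosida_inherits_structural_estimate (B : ℝ → Set ℝ) (hB : MonotoneSetMap B)
    (hB0 : (0 : ℝ) ∈ B 0) (ε : ℝ) (hε : 0 < ε) (J b : ℝ → ℝ)
    (hJb : ResolventYosidaPair B ε J b)
    (δ C : ℝ) (hδ : 0 < δ) (hC : 0 ≤ C)
    (hest : ∀ u ξ : ℝ, ξ ∈ B u → |ξ| ≤ δ * u * ξ + C) :
    ∀ u : ℝ, |b u| ≤ δ * u * b u + C := by
  intro u
  obtain ⟨h1, h2⟩ := hJb u
  have h3 := hest _ _ h2
  have h4 : δ * u * b u = δ * J u * b u + δ * ε * (b u) ^ 2 := by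
    linear_combination δ * b u * h1
  have h5 : 0 ≤ δ * ε * (b u) ^ 2 := by positivity
  linarith
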